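/- arXiv:1110.3578 — 4 statements merged into one kernel-verified Lean document; each statement's English description precedes it below -/
import Mathlib

section
/- Let n ≥ 2 and let ω = exp(2πi/n). For each k = 1, …, n let z_k = t_k·ω^k, where t_k > 0 are arbitrary positive real numbers (so z_k is a nonzero point on the ray arg z = 2πk/n). Then the product over all ordered pairs (k,l) with k ≠ l satisfies ∏_{k≠l} |z_k − z_l| ≥ n^n · ∏_{k=1}^n t_k^{n−1}. Equality holds when all t_k are equal (i.e., for a Φ_n-symmetric configuration). -/
lemma pair_ineq (a b : ℝ) (ha : 0 < a) (hb : 0 < b) (u v : ℂ) (hu : ‖u‖ = 1) (hv : ‖v‖ = 1) :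
    √a * √b * ‖u - v‖ ≤ ‖(a : ℂ) * u - b * v‖ := by
  refine (pow_le_pow_iff_left₀ (by positivity) (norm_nonneg _) two_ne_zero).1 ?_
  rw [mul_pow, mul_pow, Real.sq_sqrt ha.le, Real.sq_sqrt hb.le]
  have hu2 : ‖u‖ ^ 2 = 1 := by rw [hu]; norm_num
  have hv2 : ‖v‖ ^ 2 = 1 := by rw [hv]; norm_num
  rw [← Complex.normSq_eq_norm_sq, Complex.normSq_apply] at hu2 hv2
  rw [← Complex.normSq_eq_norm_sq, ← Complex.normSq_eq_norm_sq, Complex.normSq_apply,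
    Complex.normSq_apply]
  simp only [Complex.sub_re, Complex.sub_im, Complex.mul_re, Complex.mul_im, Complex.ofReal_re,
    Complex.ofReal_im]
  linear_combination (exp := 1) (a * b - a ^ 2) * hu2 + (a * b - b ^ 2) * hv2 + sq_nonneg (a - b)

lemma prod_roots (n : ℕ) (hn : 2 ≤ n) (ω : ℂ) (h : IsPrimitiveRoot ω n) (k : Fin n) :
    ∏ l ∈ Finset.univ.erase k, ‖ω ^ ((k : ℕ) + 1) - ω ^ ((l : ℕ) + 1)‖ = n := by
  set v : Fin n → ℂ := fun l => ω ^ ((l : ℕ) + 1) with hv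
  have hn0 : 0 < n := by omega
  have hω0 : ω ≠ 0 := h.ne_zero (by omega)
  have hinj : Function.Injective v := by
    intro a b hab
    simp only [hv, pow_succ] at hab
    exact Fin.ext (h.pow_inj a.2 b.2 (mul_right_cancel₀ hω0 hab))
  have him : Finset.univ.image v = Polynomial.nthRootsFinset n (1 : ℂ) := by
    apply Finset.eq_of_subset_of_card_le
    · intro x hx
      obtain ⟨l, -, rfl⟩ := Finset.mem_image.1 hx
      rw [Polynomial.mem_nthRootsFinset hn0]
      simp only [hv]
      rw [← pow_mul, mul_comm, pow_mul, h.pow_eq_one, one_pow]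
    · rw [Finset.card_image_of_injective _ hinj, h.card_nthRootsFinset]; simp
  have hnod : Lagrange.nodal Finset.univ v = Polynomial.X ^ n - 1 := by
    rw [Polynomial.X_pow_sub_one_eq_prod hn0 h, ← him,
      Finset.prod_image (fun a _ b _ hab => hinj hab)]
    rfl
  have hd := Lagrange.eval_nodal_derivative_eval_node_eq (v := v) (Finset.mem_univ k)
  rw [hnod, Lagrange.eval_nodal] at hd
  have := congrArg norm hd
  rw [norm_prod] at this
  rw [← this]
  simp [hv, Polynomial.derivative_X_pow, h.norm'_eq_one (by omega)]

theorem prod_offDiag_aux {n : ℕ} (f : Fin n → Fin n → ℝ) :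
    ∏ p ∈ (Finset.univ : Finset (Fin n)).offDiag, f p.1 p.2 =
      ∏ k, ∏ l ∈ Finset.univ.erase k, f k l := by
  rw [Finset.prod_sigma']
  refine Finset.prod_bij' (fun p _ => ⟨p.1, p.2⟩) (fun p _ => (p.1, p.2)) ?_ ?_ ?_ ?_ ?_ <;>
    simp [eq_comm]

lemma prod_main (n : ℕ) (hn : 2 ≤ n) (t : Fin n → ℝ) (ht : ∀ k, 0 < t k)
    (ω : ℂ) (h : IsPrimitiveRoot ω n) :
    ∏ p ∈ (Finset.univ : Finset (Fin n)).offDiag,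
      (√(t p.1) * √(t p.2) * ‖ω ^ ((p.1 : ℕ) + 1) - ω ^ ((p.2 : ℕ) + 1)‖) =
      (n : ℝ) ^ n * ∏ k, t k ^ (n - 1) := by
  have e1 : ∏ p ∈ (Finset.univ : Finset (Fin n)).offDiag, √(t p.1) = ∏ k, √(t k) ^ (n - 1) := by
    rw [prod_offDiag_aux (fun a _ => √(t a))]
    simp
  have e2 : ∏ p ∈ (Finset.univ : Finset (Fin n)).offDiag, √(t p.2) = ∏ k, √(t k) ^ (n - 1) := by
    rw [← e1]
    refine Finset.prod_bij' (fun p _ => p.swap) (fun p _ => p.swap) ?_ ?_ ?_ ?_ ?_ <;>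
      simp [eq_comm]
  rw [Finset.prod_mul_distrib, Finset.prod_mul_distrib, e1, e2,
    prod_offDiag_aux (fun a b => ‖ω ^ ((a : ℕ) + 1) - ω ^ ((b : ℕ) + 1)‖),
    Finset.prod_congr rfl (fun k _ => prod_roots n hn ω h k), ← Finset.prod_mul_distrib, mul_comm]
  congr 1
  · simp
  · refine Finset.prod_congr rfl fun k _ => ?_
    rw [← mul_pow, Real.mul_self_sqrt (ht k).le]


/-- Inequality (11) of the paper: for nonzero points `z k = t k * ω^k` on the `n`
equally spaced rays `arg z = 2πk/n` (one point on each ray, `t k > 0`), the product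
of mutual distances over all ordered pairs of distinct indices satisfies
`∏_{k ≠ l} |z k - z l| ≥ n^n * ∏ k, (t k)^(n-1)`, with equality for the
`Φₙ`-symmetric configuration where all `t k` are equal. -/
theorem dubinin_ineq_11 (n : ℕ) (hn : 2 ≤ n) (t : Fin n → ℝ) (ht : ∀ k, 0 < t k)
    (ω : ℂ) (hω : ω = Complex.exp (2 * Real.pi * Complex.I / n))
    (z : Fin n → ℂ) (hz : ∀ k, z k = (t k : ℂ) * ω ^ ((k : ℕ) + 1)) :
    (∏ p ∈ (Finset.univ : Finset (Fin n)).offDiag, ‖z p.1 - z p.2‖) ≥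
      (n : ℝ) ^ n * ∏ k, t k ^ (n - 1) ∧
    ((∀ k l, t k = t l) →
      (∏ p ∈ (Finset.univ : Finset (Fin n)).offDiag, ‖z p.1 - z p.2‖) =
        (n : ℝ) ^ n * ∏ k, t k ^ (n - 1)) := by
  have h : IsPrimitiveRoot ω n := by
    rw [hω]; exact Complex.isPrimitiveRoot_exp n (by omega)
  have hnorm : ‖ω‖ = 1 := h.norm'_eq_one (by omega)
  rw [← prod_main n hn t ht ω h]
  constructor
  · refine Finset.prod_le_prod (fun p _ => by positivity) fun p _ => ?_
    rw [hz, hz]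
    exact pair_ineq _ _ (ht _) (ht _) _ _ (by simp [hnorm]) (by simp [hnorm])
  · intro heq
    refine Finset.prod_congr rfl fun p _ => ?_
    rw [hz, hz, heq p.2 p.1, ← mul_sub, norm_mul, Real.mul_self_sqrt (ht _).le,
      Complex.norm_real, Real.norm_of_nonneg (ht _).le]
end

section
/- Let n ≥ 2 and let ω = exp(2πi/n). For each k = 1, …, n let z_k = s_k·ω^k and w_k = u_k·ω^k, where s_k, u_k > 0 and s_k ≠ u_k (two distinct points on each ray arg z = 2πk/n). Then n^{2n} · ∏_{k,l=1}^n |z_k − w_l|² ≤ (∏_{k≠l} |z_k − z_l|·|w_k − w_l|) · ∏_{k=1}^n (s_k^n − u_k^n)² / (s_k·u_k)^{n−1}, where the middle product ranges over all ordered pairs (k,l) with k ≠ l and the first product ranges over all n² pairs (k,l). Equality holds when all s_k are equal and all u_k are equal. -/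
open MeasureTheory Filter Topology in
theorem aux_exp_pd {ι : Type*} [Fintype ι] (c a : ι → ℝ) (t : ℝ) (ht : 0 ≤ t) :
    0 ≤ ∑ i, ∑ j, c i * c j * Real.exp (t * (a i * a j)) := by
  have h : ∀ i j, HasSum (fun m : ℕ => c i * c j * ((t * (a i * a j)) ^ m / (m.factorial : ℝ)))
      (c i * c j * Real.exp (t * (a i * a j))) := fun i j => by
    have := NormedSpace.expSeries_div_hasSum_exp (t * (a i * a j))
    rw [← Real.exp_eq_exp_ℝ] at this
    exact this.mul_left _
  have h2 := hasSum_sum (s := Finset.univ) (fun i _ => hasSum_sum (s := Finset.univ) (fun j _ => h i j))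
  refine h2.nonneg (fun m => ?_)
  have : ∑ i, ∑ j, c i * c j * ((t * (a i * a j)) ^ m / (m.factorial : ℝ))
      = t ^ m / (m.factorial : ℝ) * (∑ i, c i * a i ^ m) ^ 2 := by
    rw [sq, Finset.sum_mul_sum, Finset.mul_sum]
    refine Finset.sum_congr rfl fun i _ => ?_
    rw [Finset.mul_sum]
    refine Finset.sum_congr rfl fun j _ => ?_
    rw [mul_pow, mul_pow]; ring
  rw [this]; positivity

open MeasureTheory Filter Topology in
theorem aux_inv_pd {ι : Type*} [Fintype ι] (c a : ι → ℝ) (C : ℝ) (hC : 0 ≤ C) (τ : ℝ)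
    (hy : ∀ i j, 0 < a i ^ 2 + a j ^ 2 - 2 * C * (a i * a j) + τ) :
    0 ≤ ∑ i, ∑ j, c i * c j * (a i ^ 2 + a j ^ 2 - 2 * C * (a i * a j) + τ)⁻¹ := by
  have hint : ∀ i j, IntegrableOn (fun s : ℝ => c i * c j *
      Real.exp (-(a i ^ 2 + a j ^ 2 - 2 * C * (a i * a j) + τ) * s)) (Set.Ioi 0) := fun i j =>
    (integrableOn_exp_mul_Ioi (neg_lt_zero.2 (hy i j)) 0).const_mul _
  have : ∑ i, ∑ j, c i * c j * (a i ^ 2 + a j ^ 2 - 2 * C * (a i * a j) + τ)⁻¹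
      = ∫ s in Set.Ioi (0:ℝ), ∑ i, ∑ j, c i * c j *
      Real.exp (-(a i ^ 2 + a j ^ 2 - 2 * C * (a i * a j) + τ) * s) := by
    rw [integral_finsetSum]
    · refine Finset.sum_congr rfl fun i _ => ?_
      rw [integral_finsetSum]
      · refine Finset.sum_congr rfl fun j _ => ?_
        rw [integral_const_mul, integral_exp_mul_Ioi (neg_lt_zero.2 (hy i j))]
        rw [mul_zero, Real.exp_zero, neg_div_neg_eq, one_div]
      · intro j _; exact hint i j
    · intro i _; exact integrable_finsetSum _ fun j _ => hint i j
  rw [this]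
  refine setIntegral_nonneg measurableSet_Ioi fun s hs => ?_
  have hs : 0 < s := hs
  have h := aux_exp_pd (fun i => c i * Real.exp (-(a i ^ 2 + τ / 2) * s)) a (2 * C * s) (by positivity)
  refine h.trans_eq (Finset.sum_congr rfl fun i _ => Finset.sum_congr rfl fun j _ => ?_)
  rw [mul_mul_mul_comm, mul_assoc, ← Real.exp_add, ← Real.exp_add]
  ring_nf

open MeasureTheory Filter Topology in
theorem aux_log {ι : Type*} [Fintype ι] (c a : ι → ℝ) (C : ℝ) (hC : 0 ≤ C) 
    (hc : ∑ i, c i = 0)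
    (hy : ∀ i j, 0 < a i ^ 2 + a j ^ 2 - 2 * C * (a i * a j)) :
    ∑ i, ∑ j, c i * c j * Real.log (a i ^ 2 + a j ^ 2 - 2 * C * (a i * a j)) ≤ 0 := by
  set y : ι → ι → ℝ := fun i j => a i ^ 2 + a j ^ 2 - 2 * C * (a i * a j) with hyd
  set ψ : ℝ → ℝ := fun τ => ∑ i, ∑ j, c i * c j * Real.log (y i j + τ) with hψ
  have hd : ∀ τ, 0 ≤ τ → HasDerivAt ψ (∑ i, ∑ j, c i * c j * (y i j + τ)⁻¹) τ := by
    intro τ hτ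
    refine HasDerivAt.fun_sum fun i _ => HasDerivAt.fun_sum fun j _ => ?_
    have h1 : HasDerivAt (fun τ => y i j + τ) 1 τ := (hasDerivAt_id τ).const_add _
    have h0 : y i j + τ ≠ 0 := by have := hy i j; simp only [hyd]; positivity
    have := (h1.log h0).const_mul (c i * c j)
    simpa using this
  have hmono : MonotoneOn ψ (Set.Ici 0) := by
    refine monotoneOn_of_deriv_nonneg (convex_Ici 0) 
      (fun τ hτ => (hd τ hτ).continuousAt.continuousWithinAt) ?_ ?_
    · intro τ hτ
      rw [interior_Ici] at hτ
      exact (hd τ (le_of_lt hτ)).differentiableAt.differentiableWithinAt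
    · intro τ hτ
      rw [interior_Ici] at hτ
      rw [(hd τ (le_of_lt hτ)).deriv]
      exact aux_inv_pd c a C hC τ (fun i j => by have := hy i j; have h2 : 0 < τ := hτ; positivity)
  have hlim : Tendsto ψ atTop (𝓝 0) := by
    have h1 : ∀ i j, Tendsto (fun τ => c i * c j * (Real.log (y i j + τ) - Real.log τ)) atTop (𝓝 0) := by
      intro i j
      have h2 : Tendsto (fun τ : ℝ => (y i j) * τ⁻¹ + 1) atTop (𝓝 1) := by
        simpa using (tendsto_inv_atTop_zero.const_mul (y i j)).add_const (1:ℝ)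
      have h3 := (h2.log one_ne_zero).const_mul (c i * c j)
      rw [Real.log_one, mul_zero] at h3
      refine h3.congr' ?_
      filter_upwards [eventually_gt_atTop 0] with τ hτ
      rw [← Real.log_div]
      · congr 2; field_simp
      · have := hy i j; simp only [hyd]; positivity
      · positivity
    have h4 := tendsto_finsetSum Finset.univ (fun i _ => tendsto_finsetSum Finset.univ (fun j _ => h1 i j))
    simp only [Finset.sum_const_zero] at h4
    refine h4.congr fun τ => ?_
    simp only [mul_sub, Finset.sum_sub_distrib, hψ]
    have : ∑ i, ∑ j, c i * c j * Real.log τ = 0 := by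
      simp_rw [← Finset.sum_mul, ← Finset.mul_sum, hc]; simp
    rw [this, sub_zero]
  have h5 : ψ 0 ≤ 0 := by
    refine ge_of_tendsto hlim ?_
    filter_upwards [eventually_ge_atTop 0] with τ hτ
    exact hmono (Set.mem_Ici.2 le_rfl) hτ hτ
  simpa [hψ] using h5

theorem aux_four_pos (C a b c d : ℝ) (hC : 0 ≤ C) (hC1 : C < 1) (ha : 0 < a) (hb : 0 < b)
    (hc : 0 < c) (hd : 0 < d) :
    (2 - 2 * C) ^ 2 * (a * b * c * d) * ((a ^ 2 + d ^ 2 - 2 * C * (a * d)) * (b ^ 2 + c ^ 2 - 2 * C * (b * c)))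
    ≤ (a ^ 2 + b ^ 2 - 2 * C * (a * b)) * (a ^ 2 + c ^ 2 - 2 * C * (a * c)) *
      ((b ^ 2 + d ^ 2 - 2 * C * (b * d)) * (c ^ 2 + d ^ 2 - 2 * C * (c * d))) := by
  have key : ∀ x y : ℝ, 0 < x → 0 < y → 0 < x ^ 2 + y ^ 2 - 2 * C * (x * y) := by
    intro x y hx hy
    nlinarith [sq_nonneg (x - y), mul_pos hx hy, mul_pos (mul_pos hx hy) (sub_pos.2 hC1)]
  have h := aux_log (ι := Fin 4) ![1, -1, -1, 1] ![a, b, c, d] C hC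
    (by simp [Fin.sum_univ_four]) 
    (by intro i j; apply key <;> (first | (fin_cases i <;> simpa) | (fin_cases j <;> simpa)))
  have hd1 : ∀ x, 0 < x → Real.log (x ^ 2 + x ^ 2 - 2 * C * (x * x)) = Real.log (2 - 2 * C) + 2 * Real.log x := by
    intro x hx
    rw [show x ^ 2 + x ^ 2 - 2 * C * (x * x) = (2 - 2 * C) * x ^ 2 by ring,
      Real.log_mul (by linarith) (by positivity), Real.log_pow]; norm_num
  have hsym : ∀ x y, Real.log (x ^ 2 + y ^ 2 - 2 * C * (x * y)) = Real.log (y ^ 2 + x ^ 2 - 2 * C * (y * x)) := by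
    intro x y; congr 1; ring
  simp [Fin.sum_univ_four] at h
  rw [hd1 a ha, hd1 b hb, hd1 c hc, hd1 d hd, hsym b a, hsym c a, hsym d a, hsym c b, hsym d b, hsym d c] at h
  have := key a d ha hd
  have := key b c hb hc
  have := key a b ha hb
  have := key a c ha hc
  have := key b d hb hd
  have := key c d hc hd
  have h2 : 0 < 2 - 2 * C := by linarith
  rw [← Real.log_le_log_iff (by positivity) (by positivity)]
  rw [Real.log_mul, Real.log_mul, Real.log_mul, Real.log_mul, Real.log_mul, Real.log_mul,
    Real.log_mul, Real.log_mul, Real.log_mul, Real.log_pow]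
  · push_cast; linarith
  all_goals positivity

theorem aux_MN (k M N G : ℝ) (hk : 0 ≤ k) (hk1 : k ≤ 1) (hG : 0 < G) (hM : 2 * G ≤ M)
    (hN : 2 * G ≤ N) :
    0 ≤ M ^ 2 + N ^ 2 - (4 - 4 * k ^ 2) * G ^ 2 + 2 * k * (M * N) ∧
    (2 + 2 * k) ^ 2 * (M ^ 2 - (2 - 2 * k) * G ^ 2) * (N ^ 2 - (2 - 2 * k) * G ^ 2) ≤
    (M ^ 2 + N ^ 2 - (4 - 4 * k ^ 2) * G ^ 2 + 2 * k * (M * N)) ^ 2 := by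
  have hM0 : 0 < M := by linarith
  have hN0 : 0 < N := by linarith
  constructor
  · have t1 : (2 * G) ^ 2 ≤ M ^ 2 := by gcongr
    have t2 : 0 ≤ k * (M * N) := by positivity
    nlinarith [sq_nonneg N, sq_nonneg (k * G)]
  have e3 : (M ^ 2 + N ^ 2 - (4 - 4 * k ^ 2) * G ^ 2 + 2 * k * (M * N)) ^ 2
    - (2 + 2 * k) ^ 2 * (M ^ 2 - (2 - 2 * k) * G ^ 2) * (N ^ 2 - (2 - 2 * k) * G ^ 2)
    = (M - N) ^ 2 * ((1 + k) ^ 2 * (M + N) ^ 2 - 2 * k * ((1 + k) * (M ^ 2 + N ^ 2 - (4 - 4 * k) * G ^ 2)) + k ^ 2 * (M - N) ^ 2) := by ring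
  have e4 : 0 ≤ (1 + k) ^ 2 * (M + N) ^ 2 - 2 * k * ((1 + k) * (M ^ 2 + N ^ 2 - (4 - 4 * k) * G ^ 2)) := by
    have t0 : 0 ≤ 1 - k := by linarith
    have t1 : 0 ≤ k * (1 + k) * ((1 - k) * G ^ 2) := by positivity
    have t2 : 0 ≤ (1 + k) * (1 - k) * (M ^ 2 + N ^ 2) := by positivity
    have t3 : 0 ≤ (1 + k) ^ 2 * (M * N) := by positivity
    linarith
  have := mul_nonneg (sq_nonneg (M - N)) (add_nonneg e4 (by positivity : 0 ≤ k ^ 2 * (M - N) ^ 2))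
  linarith

set_option maxHeartbeats 1000000 in
theorem aux_four_neg (k a b c d : ℝ) (hk : 0 ≤ k) (hk1 : k ≤ 1) (ha : 0 < a) (hb : 0 < b)
    (hc : 0 < c) (hd : 0 < d) :
    (2 + 2 * k) ^ 2 * (a * b * c * d) * ((a ^ 2 + d ^ 2 + 2 * k * (a * d)) * (b ^ 2 + c ^ 2 + 2 * k * (b * c)))
    ≤ (a ^ 2 + b ^ 2 + 2 * k * (a * b)) * (a ^ 2 + c ^ 2 + 2 * k * (a * c)) *
      ((b ^ 2 + d ^ 2 + 2 * k * (b * d)) * (c ^ 2 + d ^ 2 + 2 * k * (c * d))) := by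
  obtain ⟨g, hg, hg2⟩ : ∃ g, 0 < g ∧ g ^ 2 = a * d :=
    ⟨√(a * d), by positivity, Real.sq_sqrt (by positivity)⟩
  obtain ⟨h, hh, hh2⟩ : ∃ g, 0 < g ∧ g ^ 2 = b * c :=
    ⟨√(b * c), by positivity, Real.sq_sqrt (by positivity)⟩
  have e1 : (a ^ 2 + b ^ 2 + 2 * k * (a * b)) * (a ^ 2 + c ^ 2 + 2 * k * (a * c)) *
      ((b ^ 2 + d ^ 2 + 2 * k * (b * d)) * (c ^ 2 + d ^ 2 + 2 * k * (c * d)))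
      = ((a + d) ^ 2 * (b * c) + (b + c) ^ 2 * (a * d) + (a * d + b * c) ^ 2
          - (8 - 4 * k ^ 2) * ((a * d) * (b * c)) + k * ((a + d) * (b + c) * (a * d + b * c))) ^ 2
        + (1 - k ^ 2) * ((a - d) * (b - c) * (a * d - b * c)) ^ 2 := by ring
  have e2 : (2 + 2 * k) ^ 2 * (a * b * c * d) * ((a ^ 2 + d ^ 2 + 2 * k * (a * d)) * (b ^ 2 + c ^ 2 + 2 * k * (b * c)))
     = (2 + 2 * k) ^ 2 * (((a + d) * h) ^ 2 - (2 - 2 * k) * (g * h) ^ 2) * (((b + c) * g) ^ 2 - (2 - 2 * k) * (g * h) ^ 2) := by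
    simp only [mul_pow, hg2, hh2]; ring
  rw [e1, e2, ← hg2, ← hh2]
  have hM : 2 * (g * h) ≤ (a + d) * h := by
    have : 2 * g ≤ a + d := by
      apply (pow_le_pow_iff_left₀ (by positivity) (by positivity) two_ne_zero).1
      linarith [sq_nonneg (a - d)]
    rw [← mul_assoc]; exact mul_le_mul_of_nonneg_right this hh.le
  have hN : 2 * (g * h) ≤ (b + c) * g := by
    have : 2 * h ≤ b + c := by
      apply (pow_le_pow_iff_left₀ (by positivity) (by positivity) two_ne_zero).1
      linarith [sq_nonneg (b - c)]
    rw [mul_comm g h, ← mul_assoc]; exact mul_le_mul_of_nonneg_right this hg.le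
  have hV : ((a + d) * h) ^ 2 + ((b + c) * g) ^ 2 - (4 - 4 * k ^ 2) * (g * h) ^ 2 + 2 * k * (((a + d) * h) * ((b + c) * g)) ≤
     ((a + d) ^ 2 * h ^ 2 + (b + c) ^ 2 * g ^ 2 + (g ^ 2 + h ^ 2) ^ 2
          - (8 - 4 * k ^ 2) * (g ^ 2 * h ^ 2) + k * ((a + d) * (b + c) * (g ^ 2 + h ^ 2))) := by
    have t1 : 0 ≤ (g ^ 2 - h ^ 2) ^ 2 := sq_nonneg _
    have t2 : 0 ≤ k * ((a + d) * (b + c) * (g - h) ^ 2) := by positivity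
    linarith
  have hS : 0 ≤ (1 - k ^ 2) * ((a - d) * (b - c) * (g ^ 2 - h ^ 2)) ^ 2 := by
    have : 0 ≤ 1 - k ^ 2 := by nlinarith
    positivity
  obtain ⟨hV0, hfin⟩ := aux_MN k ((a + d) * h) ((b + c) * g) (g * h) hk hk1 (by positivity) hM hN
  refine le_trans ?_ (le_add_of_nonneg_right hS)
  exact le_trans hfin (pow_le_pow_left₀ hV0 hV 2)

theorem aux_four (C a b c d : ℝ) (hC : -1 ≤ C) (hC1 : C < 1) (ha : 0 < a) (hb : 0 < b)
    (hc : 0 < c) (hd : 0 < d) :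
    (2 - 2 * C) ^ 2 * (a * b * c * d) * ((a ^ 2 + d ^ 2 - 2 * C * (a * d)) * (b ^ 2 + c ^ 2 - 2 * C * (b * c)))
    ≤ (a ^ 2 + b ^ 2 - 2 * C * (a * b)) * (a ^ 2 + c ^ 2 - 2 * C * (a * c)) *
      ((b ^ 2 + d ^ 2 - 2 * C * (b * d)) * (c ^ 2 + d ^ 2 - 2 * C * (c * d))) := by
  rcases le_total 0 C with h | h
  · exact aux_four_pos C a b c d h hC1 ha hb hc hd
  · have := aux_four_neg (-C) a b c d (by linarith) (by linarith) ha hb hc hd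
    simpa [sub_eq_add_neg] using this

theorem aux_offDiag {n : ℕ} (F : Fin n → Fin n → ℝ) :
    ∏ p ∈ (Finset.univ : Finset (Fin n)).offDiag, F p.1 p.2
      = ∏ k, ∏ l ∈ Finset.univ.erase k, F k l := by
  rw [Finset.prod_sigma']
  refine Finset.prod_bij' (fun p _ => ⟨p.1, p.2⟩) (fun q _ => (q.1, q.2)) ?_ ?_ ?_ ?_ ?_
  · intro p hp; simp at hp ⊢; exact fun h => hp h.symm
  · intro p hp; simp at hp ⊢; exact fun h => hp h.symm
  · intro p hp; rfl
  · intro p hp; rfl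
  · intro p hp; rfl

theorem aux_swap {n : ℕ} (F : Fin n → Fin n → ℝ) :
    ∏ p ∈ (Finset.univ : Finset (Fin n)).offDiag, F p.1 p.2
      = ∏ p ∈ (Finset.univ : Finset (Fin n)).offDiag, F p.2 p.1 := by
  refine Finset.prod_bij' (fun p _ => p.swap) (fun q _ => q.swap) ?_ ?_ ?_ ?_ ?_
  · intro p hp; simp at hp ⊢; exact fun h => hp h.symm
  · intro p hp; simp at hp ⊢; exact fun h => hp h.symm
  · intro p hp; simp
  · intro p hp; simp
  · intro p hp; simp

open Polynomial in
theorem aux_poly (n : ℕ) (hn : 0 < n) (ω : ℂ) (h : IsPrimitiveRoot ω n) (y : ℂ) :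
    ∏ l : Fin n, ((X : ℂ[X]) - C (y * ω ^ ((l : ℕ) + 1))) = X ^ n - C (y ^ n) := by
  have := X_pow_sub_C_eq_prod h hn (α := ω * y) (a := y ^ n) (by rw [mul_pow, h.pow_eq_one, one_mul])
  rw [this, ← Fin.prod_univ_eq_prod_range (fun i => (X : ℂ[X]) - C (ω ^ i * (ω * y)))]
  refine Finset.prod_congr rfl fun l _ => ?_
  congr 2; ring

open Polynomial in
theorem aux_prod (n : ℕ) (hn : 0 < n) (ω : ℂ) (h : IsPrimitiveRoot ω n) (x y : ℝ) (k : Fin n) :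
    ∏ l : Fin n, ‖(x : ℂ) * ω ^ ((k : ℕ) + 1) - y * ω ^ ((l : ℕ) + 1)‖ = |x ^ n - y ^ n| := by
  have := congrArg (eval ((x : ℂ) * ω ^ ((k : ℕ) + 1))) (aux_poly n hn ω h y)
  rw [eval_prod] at this
  simp only [eval_sub, eval_X, eval_C, eval_pow] at this
  rw [← norm_prod, this, mul_pow, ← pow_mul, mul_comm _ n, pow_mul, h.pow_eq_one, one_pow, mul_one]
  rw [← Complex.ofReal_pow, ← Complex.ofReal_pow, ← Complex.ofReal_sub, Complex.norm_real, Real.norm_eq_abs]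

open Polynomial in
theorem aux_n (n : ℕ) (hn : 0 < n) (ω : ℂ) (h : IsPrimitiveRoot ω n) (k : Fin n) :
    ∏ l ∈ Finset.univ.erase k, ‖ω ^ ((k : ℕ) + 1) - ω ^ ((l : ℕ) + 1)‖ = n := by
  have h1 := aux_poly n hn ω h 1
  rw [← Finset.mul_prod_erase _ _ (Finset.mem_univ k)] at h1
  have := congrArg (fun p => eval (ω ^ ((k : ℕ) + 1)) (derivative p)) h1
  simp [derivative_mul, eval_prod, -map_pow, derivative_X_pow] at this
  rw [← norm_prod, this]
  simp [h.norm'_eq_one hn.ne']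

theorem aux_norm (x y : ℝ) (p q : ℂ) (hp : ‖p‖ = 1) (hq : ‖q‖ = 1) :
    ‖(x : ℂ) * p - y * q‖ ^ 2 = x ^ 2 + y ^ 2 - 2 * (p.re * q.re + p.im * q.im) * (x * y) := by
  have h1 : p.re * p.re + p.im * p.im = 1 := by
    rw [← Complex.normSq_apply, Complex.normSq_eq_norm_sq, hp]; norm_num
  have h2 : q.re * q.re + q.im * q.im = 1 := by
    rw [← Complex.normSq_apply, Complex.normSq_eq_norm_sq, hq]; norm_num
  rw [← Complex.normSq_eq_norm_sq, Complex.normSq_apply]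
  simp
  linear_combination x ^ 2 * h1 + y ^ 2 * h2

set_option maxHeartbeats 2000000 in
theorem dubinin_thm3_two_points (n : ℕ) (hn : 2 ≤ n) (s u : Fin n → ℝ)
    (hs : ∀ k, 0 < s k) (hu : ∀ k, 0 < u k) (hsu : ∀ k, s k ≠ u k)
    (ω : ℂ) (hω : ω = Complex.exp (2 * Real.pi * Complex.I / n))
    (z w : Fin n → ℂ)
    (hz : ∀ k, z k = (s k : ℂ) * ω ^ ((k : ℕ) + 1))
    (hw : ∀ k, w k = (u k : ℂ) * ω ^ ((k : ℕ) + 1)) :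
    (n : ℝ) ^ (2 * n) * ∏ k : Fin n, ∏ l : Fin n, ‖z k - w l‖ ^ 2 ≤
      (∏ p ∈ (Finset.univ : Finset (Fin n)).offDiag,
          ‖z p.1 - z p.2‖ * ‖w p.1 - w p.2‖) *
        ∏ k : Fin n, (s k ^ n - u k ^ n) ^ 2 / (s k * u k) ^ (n - 1) ∧
    ((∀ k l, s k = s l) → (∀ k l, u k = u l) →
      (n : ℝ) ^ (2 * n) * ∏ k : Fin n, ∏ l : Fin n, ‖z k - w l‖ ^ 2 =
        (∏ p ∈ (Finset.univ : Finset (Fin n)).offDiag,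
            ‖z p.1 - z p.2‖ * ‖w p.1 - w p.2‖) *
          ∏ k : Fin n, (s k ^ n - u k ^ n) ^ 2 / (s k * u k) ^ (n - 1)) := by
  have hn0 : 0 < n := by omega
  have hprim : IsPrimitiveRoot ω n := by rw [hω]; exact Complex.isPrimitiveRoot_exp n hn0.ne'
  have hr : ∀ k : Fin n, ‖ω ^ ((k : ℕ) + 1)‖ = 1 := fun k => by
    rw [norm_pow, hprim.norm'_eq_one hn0.ne', one_pow]
  have hinj : ∀ k l : Fin n, k ≠ l → ω ^ ((k : ℕ) + 1) ≠ ω ^ ((l : ℕ) + 1) := by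
    intro k l hkl h
    have hω0 : ω ≠ 0 := hprim.ne_zero hn0.ne'
    rw [pow_succ, pow_succ] at h
    exact hkl (Fin.ext (hprim.pow_inj k.2 l.2 (mul_right_cancel₀ hω0 h)))
  set r : Fin n → ℂ := fun k => ω ^ ((k : ℕ) + 1) with hrd
  set f : Fin n → Fin n → ℝ := fun k l => ‖r k - r l‖ ^ 2 * (s k * u k) * ‖z k - w l‖ ^ 2 with hf
  set g : Fin n → Fin n → ℝ := fun k l =>
    ‖(s k : ℂ) * r k - u k * r l‖ ^ 2 * (‖z k - z l‖ * ‖w k - w l‖) with hg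
  set L := ∏ p ∈ (Finset.univ : Finset (Fin n)).offDiag, f p.1 p.2 with hL
  set R := ∏ p ∈ (Finset.univ : Finset (Fin n)).offDiag, g p.1 p.2 with hR
  have hf0 : ∀ k l, 0 ≤ f k l := fun k l => by
    have := hs k; have := hu k; simp only [hf]; positivity
  have hg0 : ∀ k l, 0 ≤ g k l := fun k l => by simp only [hg]; positivity
  have hL0 : 0 ≤ L := Finset.prod_nonneg fun p _ => hf0 _ _
  have hR0 : 0 ≤ R := Finset.prod_nonneg fun p _ => hg0 _ _
  have hLL : L * L = ∏ p ∈ (Finset.univ : Finset (Fin n)).offDiag, f p.1 p.2 * f p.2 p.1 := by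
    rw [Finset.prod_mul_distrib, ← aux_swap f]
  have hRR : R * R = ∏ p ∈ (Finset.univ : Finset (Fin n)).offDiag, g p.1 p.2 * g p.2 p.1 := by
    rw [Finset.prod_mul_distrib, ← aux_swap g]
  -- expansions
  have hff : ∀ k l, ∃ C : ℝ, (C = (r k).re * (r l).re + (r k).im * (r l).im) ∧ 
      f k l * f l k = (2 - 2 * C) ^ 2 * (s k * u k * s l * u l) *
        ((s k ^ 2 + u l ^ 2 - 2 * C * (s k * u l)) * (u k ^ 2 + s l ^ 2 - 2 * C * (u k * s l))) ∧
      g k l * g l k = (s k ^ 2 + u k ^ 2 - 2 * C * (s k * u k)) * (s k ^ 2 + s l ^ 2 - 2 * C * (s k * s l)) *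
      ((u k ^ 2 + u l ^ 2 - 2 * C * (u k * u l)) * (s l ^ 2 + u l ^ 2 - 2 * C * (s l * u l))) := by
    intro k l
    refine ⟨_, rfl, ?_, ?_⟩
    · have e1 := aux_norm 1 1 (r k) (r l) (hr k) (hr l)
      have e2 := aux_norm (s k) (u l) (r k) (r l) (hr k) (hr l)
      have e3 := aux_norm (s l) (u k) (r l) (r k) (hr l) (hr k)
      simp only [Complex.ofReal_one, one_mul] at e1
      simp only [hf, hz, hw]
      rw [norm_sub_rev (r l) (r k), e1, e2, e3]
      ring
    · have e1 := aux_norm (s k) (u k) (r k) (r l) (hr k) (hr l)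
      have e2 := aux_norm (s k) (s l) (r k) (r l) (hr k) (hr l)
      have e3 := aux_norm (u k) (u l) (r k) (r l) (hr k) (hr l)
      have e4 := aux_norm (s l) (u l) (r l) (r k) (hr l) (hr k)
      have e5 : g k l * g l k = ‖(s k : ℂ) * r k - u k * r l‖ ^ 2 * ‖(s k : ℂ) * r k - s l * r l‖ ^ 2 *
          (‖(u k : ℂ) * r k - u l * r l‖ ^ 2 * ‖(s l : ℂ) * r l - u l * r k‖ ^ 2) := by
        simp only [hg, hz, hw]
        rw [norm_sub_rev ((s l : ℂ) * ω ^ ((l : ℕ) + 1)) ((s k : ℂ) * ω ^ ((k : ℕ) + 1)),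
          norm_sub_rev ((u l : ℂ) * ω ^ ((l : ℕ) + 1)) ((u k : ℂ) * ω ^ ((k : ℕ) + 1))]
        ring
      rw [e5, e1, e2, e3, e4]
      ring
  have hle : L ≤ R := by
    refine (mul_self_le_mul_self_iff hL0 hR0).2 ?_
    rw [hLL, hRR]
    refine Finset.prod_le_prod (fun p _ => mul_nonneg (hf0 _ _) (hf0 _ _)) fun p hp => ?_
    have hne : p.1 ≠ p.2 := (Finset.mem_offDiag.1 hp).2.2
    obtain ⟨C, hC, h1, h2⟩ := hff p.1 p.2
    rw [h1, h2]
    have e1 := aux_norm 1 1 (r p.1) (r p.2) (hr _) (hr _)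
    have e2 := aux_norm 1 (-1) (r p.1) (r p.2) (hr _) (hr _)
    rw [← hC] at e1 e2
    have p1 : 0 < ‖((1 : ℝ) : ℂ) * r p.1 - ((1 : ℝ) : ℂ) * r p.2‖ := by
      rw [norm_pos_iff]; simpa [sub_eq_zero] using hinj _ _ hne
    refine aux_four C _ _ _ _ ?_ ?_ (hs _) (hu _) (hs _) (hu _)
    · nlinarith [sq_nonneg ‖((1 : ℝ) : ℂ) * r p.1 - ((-1 : ℝ) : ℂ) * r p.2‖]
    · nlinarith [pow_pos p1 2]
  set E := ∏ k : Fin n, (s k - u k) ^ 2 / (s k * u k) ^ (n - 1) with hE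
  have hE0 : 0 ≤ E := Finset.prod_nonneg fun k _ => by
    have := hs k; have := hu k; positivity
  have hLE : (n : ℝ) ^ (2 * n) * ∏ k : Fin n, ∏ l : Fin n, ‖z k - w l‖ ^ 2 = L * E := by
    rw [hL, aux_offDiag f, hE, ← Finset.prod_mul_distrib]
    have : (n : ℝ) ^ (2 * n) = ∏ k : Fin n, (n : ℝ) ^ 2 := by simp [pow_mul]
    rw [this, ← Finset.prod_mul_distrib]
    refine Finset.prod_congr rfl fun k _ => ?_
    simp only [hf]
    have hnn : ∏ l ∈ Finset.univ.erase k, ‖r k - r l‖ ^ 2 = (n : ℝ) ^ 2 := by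
      rw [Finset.prod_pow, aux_n n hn0 ω hprim k]
    rw [Finset.prod_mul_distrib, Finset.prod_mul_distrib, hnn,
      Finset.prod_const, Finset.card_erase_of_mem (Finset.mem_univ k), Finset.card_univ, Fintype.card_fin,
      ← Finset.mul_prod_erase _ _ (Finset.mem_univ k)]
    have : ‖z k - w k‖ ^ 2 = (s k - u k) ^ 2 := by
      rw [hz, hw, ← sub_mul, norm_mul, hr, mul_one, ← Complex.ofReal_sub, Complex.norm_real,
        Real.norm_eq_abs, sq_abs]
    rw [this]
    have := hs k; have := hu k
    field_simp
  have hRE : (∏ p ∈ (Finset.univ : Finset (Fin n)).offDiag,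
          ‖z p.1 - z p.2‖ * ‖w p.1 - w p.2‖) *
        ∏ k : Fin n, (s k ^ n - u k ^ n) ^ 2 / (s k * u k) ^ (n - 1) = R * E := by
    have hR2 : R = (∏ k, ∏ l ∈ Finset.univ.erase k, ‖(s k : ℂ) * r k - u k * r l‖ ^ 2) *
        ∏ p ∈ (Finset.univ : Finset (Fin n)).offDiag, (‖z p.1 - z p.2‖ * ‖w p.1 - w p.2‖) := by
      rw [← aux_offDiag (fun k l => ‖(s k : ℂ) * r k - u k * r l‖ ^ 2), ← Finset.prod_mul_distrib]
    rw [hR2,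
      mul_comm (∏ k : Fin n, _) (∏ p ∈ _, _), mul_assoc, hE, ← Finset.prod_mul_distrib]
    congr 1
    refine Finset.prod_congr rfl fun k _ => ?_
    have h1 := aux_prod n hn0 ω hprim (s k) (u k) k
    rw [← Finset.mul_prod_erase _ _ (Finset.mem_univ k), ← sub_mul, norm_mul, hr, mul_one,
      ← Complex.ofReal_sub, Complex.norm_real, Real.norm_eq_abs] at h1
    rw [← sq_abs (s k ^ n - u k ^ n), ← h1, Finset.prod_pow, mul_pow, sq_abs]
    ring
  rw [hLE, hRE]
  refine ⟨mul_le_mul_of_nonneg_right hle hE0, fun hss huu => ?_⟩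
  congr 1
  refine (mul_self_inj hL0 hR0).1 ?_
  rw [hLL, hRR]
  refine Finset.prod_congr rfl fun p _ => ?_
  obtain ⟨C, hC, h1, h2⟩ := hff p.1 p.2
  rw [h1, h2, hss p.2 p.1, huu p.2 p.1]
  ring
end

section
/- Let n ≥ 2 and 0 < r < R. Let z_1, …, z_n be pairwise distinct points with |z_k| = r for all k, and set ζ_k = (R/r)·z_k (so |ζ_k| = R and arg ζ_k = arg z_k). Let z_k* = r·exp(2πik/n) and ζ_k* = R·exp(2πik/n) for k = 1, …, n. Then for all real numbers α and β, (∏_{k,l=1}^n |z_k* − ζ_l*|^{2αβ}) / (∏_{k≠l} |z_k* − z_l*|^{α²}·|ζ_k* − ζ_l*|^{β²}) ≤ (∏_{k,l=1}^n |z_k − ζ_l|^{2αβ}) / (∏_{k≠l} |z_k − z_l|^{α²}·|ζ_k − ζ_l|^{β²}), where the products in the numerators range over all n² pairs (k,l), the products in the denominators range over all ordered pairs (k,l) with k ≠ l, and all exponentiations are real powers of strictly positive real bases. -/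
noncomputable def dubF (r R α β : ℝ) (x : ℝ) : ℝ :=
  α * β * Real.log (r ^ 2 + R ^ 2 - 2 * r * R * Real.cos x)
    - (α ^ 2 + β ^ 2) / 2 * Real.log (1 - Real.cos x)
    - (α ^ 2 / 2 * Real.log (2 * r ^ 2) + β ^ 2 / 2 * Real.log (2 * R ^ 2))

lemma dub_cos_lt {x : ℝ} (h0 : 0 < x) (h1 : x < 2 * Real.pi) : 0 < 1 - Real.cos x := by
  have hs : 0 < Real.sin (x / 2) := Real.sin_pos_of_pos_of_lt_pi (by linarith) (by linarith)
  have h2 : Real.cos x = 2 * Real.cos (x / 2) ^ 2 - 1 := by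
    rw [← Real.cos_two_mul]; congr 1; ring
  nlinarith [Real.sin_sq_add_cos_sq (x / 2), pow_pos hs 2]

lemma dub_D_pos {r R : ℝ} (hr : 0 < r) (hrR : r < R) (x : ℝ) :
    0 < r ^ 2 + R ^ 2 - 2 * r * R * Real.cos x := by
  have h1 : 0 < (R - r) ^ 2 := by apply pow_pos; linarith
  have h2 : 0 ≤ (r * R) * (1 - Real.cos x) :=
    mul_nonneg (mul_pos hr (hr.trans hrR)).le (by linarith [Real.cos_le_one x])
  nlinarith

lemma dub_f2_nonneg {A p u a N D : ℝ} (b : ℝ) (hA : 0 < A) (hp : 0 < p) (hu : 0 < u) (hu2 : u ≤ 2)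
    (hD : D = A + p * u) (hN : N = p * (A - A * u - p * u)) :
    0 ≤ a * b * (N / D ^ 2) + (a ^ 2 + b ^ 2) / 2 * (1 / u) := by
  have hpu := mul_pos hp hu
  have hApu := mul_pos hA hpu
  have hDp : 0 < D := by rw [hD]; positivity
  have h1 : N * u ≤ D ^ 2 := by rw [hN, hD]; nlinarith [mul_pos hApu hu, sq_nonneg (p * u), sq_nonneg A]
  have h2 : -(N * u) ≤ D ^ 2 := by
    rw [hN, hD]; nlinarith [mul_nonneg hApu.le (sub_nonneg.2 hu2), sq_nonneg (p * u), sq_nonneg A]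
  have e : a * b * (N / D ^ 2) + (a ^ 2 + b ^ 2) / 2 * (1 / u)
      = (2 * (a * b) * (N * u) + (a ^ 2 + b ^ 2) * D ^ 2) / (2 * u * D ^ 2) := by
    field_simp
  rw [e]
  apply div_nonneg _ (by positivity)
  nlinarith [mul_nonneg (sq_nonneg (a + b)) (by linarith : 0 ≤ D ^ 2 + N * u),
    mul_nonneg (sq_nonneg (a - b)) (by linarith : 0 ≤ D ^ 2 - N * u)]

lemma dubF_convex {r R : ℝ} (hr : 0 < r) (hrR : r < R) (α β : ℝ) :
    ConvexOn ℝ (Set.Ioo 0 (2 * Real.pi)) (dubF r R α β) := by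
  have hf' : ∀ x ∈ Set.Ioo 0 (2 * Real.pi), HasDerivAt (dubF r R α β)
      (α * β * ((2 * r * R * Real.sin x) / (r ^ 2 + R ^ 2 - 2 * r * R * Real.cos x))
        - (α ^ 2 + β ^ 2) / 2 * (Real.sin x / (1 - Real.cos x))) x := by
    intro x hx
    have hD := dub_D_pos hr hrR x
    have hu := dub_cos_lt hx.1 hx.2
    have h1 : HasDerivAt (fun x => r ^ 2 + R ^ 2 - 2 * r * R * Real.cos x)
        (2 * r * R * Real.sin x) x := by
      exact (((Real.hasDerivAt_cos x).const_mul (2 * r * R)).const_sub (r ^ 2 + R ^ 2)).congr_deriv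
        (by ring)
    have h2 : HasDerivAt (fun x => 1 - Real.cos x) (Real.sin x) x := by
      exact ((Real.hasDerivAt_cos x).const_sub 1).congr_deriv (by ring)
    exact (((h1.log hD.ne').const_mul (α * β)).sub
      ((h2.log hu.ne').const_mul ((α ^ 2 + β ^ 2) / 2))).sub_const _
  apply convexOn_of_hasDerivWithinAt2_nonneg (convex_Ioo _ _)
    (f' := fun x => α * β * ((2 * r * R * Real.sin x) / (r ^ 2 + R ^ 2 - 2 * r * R * Real.cos x))
        - (α ^ 2 + β ^ 2) / 2 * (Real.sin x / (1 - Real.cos x)))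
    (f'' := fun x => α * β * ((2 * r * R * Real.cos x * (r ^ 2 + R ^ 2 - 2 * r * R * Real.cos x)
      - 2 * r * R * Real.sin x * (2 * r * R * Real.sin x))
        / (r ^ 2 + R ^ 2 - 2 * r * R * Real.cos x) ^ 2)
        - (α ^ 2 + β ^ 2) / 2 * ((Real.cos x * (1 - Real.cos x) - Real.sin x * Real.sin x)
          / (1 - Real.cos x) ^ 2))
  · exact fun x hx => (hf' x hx).continuousAt.continuousWithinAt
  · rw [interior_Ioo]; exact fun x hx => (hf' x hx).hasDerivWithinAt
  · rw [interior_Ioo]; intro x hx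
    have hD := dub_D_pos hr hrR x
    have hu := dub_cos_lt hx.1 hx.2
    have h1 : HasDerivAt (fun x => r ^ 2 + R ^ 2 - 2 * r * R * Real.cos x)
        (2 * r * R * Real.sin x) x := by
      exact (((Real.hasDerivAt_cos x).const_mul (2 * r * R)).const_sub (r ^ 2 + R ^ 2)).congr_deriv
        (by ring)
    have h2 : HasDerivAt (fun x => 1 - Real.cos x) (Real.sin x) x := by
      exact ((Real.hasDerivAt_cos x).const_sub 1).congr_deriv (by ring)
    have h3 := (Real.hasDerivAt_sin x)
    exact ((((h3.const_mul (2 * r * R)).div h1 hD.ne').const_mul (α * β)).sub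
      ((h3.div h2 hu.ne').const_mul ((α ^ 2 + β ^ 2) / 2))).hasDerivWithinAt
  · rw [interior_Ioo]; intro x hx
    have hu := dub_cos_lt hx.1 hx.2
    have hs := Real.sin_sq_add_cos_sq x
    have e1 : (Real.cos x * (1 - Real.cos x) - Real.sin x * Real.sin x)
          / (1 - Real.cos x) ^ 2 = - (1 / (1 - Real.cos x)) := by
      field_simp
      linarith
    have hR := hr.trans hrR
    have := dub_f2_nonneg (a := α) β (A := (R - r) ^ 2) (p := 2 * r * R) (u := 1 - Real.cos x)
      (pow_pos (by linarith) 2) (by positivity) hu (by linarith [Real.neg_one_le_cos x])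
      (D := r ^ 2 + R ^ 2 - 2 * r * R * Real.cos x)
      (N := 2 * r * R * Real.cos x * (r ^ 2 + R ^ 2 - 2 * r * R * Real.cos x)
      - 2 * r * R * Real.sin x * (2 * r * R * Real.sin x)) (by ring)
      (by linear_combination (-4 * r ^ 2 * R ^ 2) * hs)
    simp only [e1]
    linarith

lemma dubF_periodic (r R α β : ℝ) : Function.Periodic (dubF r R α β) (2 * Real.pi) := by
  intro x; simp [dubF]

lemma dub_sum_shift {n : ℕ} [NeZero n] (g : Fin n → Fin n → ℝ) :
    ∑ p ∈ (Finset.univ : Finset (Fin n)).offDiag, g p.1 p.2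
      = ∑ j ∈ Finset.univ.erase (0 : Fin n), ∑ k, g (k + j) k := by
  rw [← Finset.sum_product']
  symm
  refine Finset.sum_bij' (fun q _ => (q.2 + q.1, q.2)) (fun p _ => (p.1 - p.2, p.2)) ?_ ?_ ?_ ?_ ?_
  · rintro ⟨j, k⟩ h
    simpa using h
  · rintro ⟨j, k⟩ h
    simpa [sub_eq_zero] using h
  · rintro ⟨j, k⟩ h
    simp
  · rintro ⟨j, k⟩ h
    simp
  · rintro ⟨j, k⟩ h
    simp

lemma dub_val_add {n : ℕ} [NeZero n] (k j : Fin n) :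
    (((k + j : Fin n) : ℕ) : ℝ) + n * (if k + j < k then 1 else 0) = (k : ℕ) + (j : ℕ) := by
  have : ((k + j : Fin n) : ℕ) + n * (if k + j < k then 1 else 0) = (k : ℕ) + (j : ℕ) := by
    have hk := k.2
    have hj := j.2
    simp only [Fin.lt_def, Fin.val_add]
    rcases lt_or_ge ((k : ℕ) + j) n with h | h
    · rw [Nat.mod_eq_of_lt h, if_neg (by omega)]; omega
    · rw [Nat.mod_eq_sub_mod h, Nat.mod_eq_of_lt (by omega), if_pos (by omega)]; omega
  exact_mod_cast this

lemma dub_count {n : ℕ} [NeZero n] (j : Fin n) :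
    ∑ k : Fin n, (if k + j < k then (1 : ℝ) else 0) = (j : ℕ) := by
  have h := Finset.sum_congr (rfl : (Finset.univ : Finset (Fin n)) = _)
    (fun k _ => dub_val_add k j)
  rw [Finset.sum_add_distrib, Finset.sum_add_distrib, ← Finset.mul_sum] at h
  have h2 : ∑ k : Fin n, (((k + j : Fin n) : ℕ) : ℝ) = ∑ k : Fin n, ((k : ℕ) : ℝ) :=
    Equiv.sum_comp (Equiv.addRight j) (fun k : Fin n => ((k : ℕ) : ℝ))
  rw [h2] at h
  have hn : (n : ℝ) ≠ 0 := Nat.cast_ne_zero.2 (NeZero.ne n)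
  apply mul_left_cancel₀ hn
  simp at h
  simpa using h

lemma dub_jensen_mono {n : ℕ} [NeZero n] {f : ℝ → ℝ} (hc : ConvexOn ℝ (Set.Ioo 0 (2 * Real.pi)) f)
    (hp : Function.Periodic f (2 * Real.pi)) (a : Fin n → ℝ) (ha : StrictMono a)
    (hlt : ∀ k l, a k - a l < 2 * Real.pi) :
    ∑ p ∈ (Finset.univ : Finset (Fin n)).offDiag,
      f (2 * Real.pi * ((p.1 : ℕ) + 1) / n - 2 * Real.pi * ((p.2 : ℕ) + 1) / n)
      ≤ ∑ p ∈ (Finset.univ : Finset (Fin n)).offDiag, f (a p.1 - a p.2) := by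
  have hn : (0 : ℝ) < n := Nat.cast_pos.2 (NeZero.pos n)
  rw [dub_sum_shift (fun k l => f (a k - a l)), dub_sum_shift (fun k l : Fin n =>
    f (2 * Real.pi * ((k : ℕ) + 1) / n - 2 * Real.pi * ((l : ℕ) + 1) / n))]
  refine Finset.sum_le_sum fun j hj => ?_
  have hj0 : j ≠ 0 := (Finset.mem_erase.1 hj).1
  set c : Fin n → ℝ := fun k => if k + j < k then (1 : ℝ) else 0 with hcdef
  have hstar : ∀ k : Fin n, f (2 * Real.pi * (((k + j : Fin n) : ℕ) + 1) / n
      - 2 * Real.pi * ((k : ℕ) + 1) / n) = f (2 * Real.pi * (j : ℕ) / n) := by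
    intro k
    have h := dub_val_add k j
    split_ifs at h with hk
    · rw [← hp]
      congr 1
      field_simp
      linarith
    · congr 1
      field_simp
      linarith
  have hper : ∀ k : Fin n, f (a (k + j) - a k) = f (a (k + j) - a k + 2 * Real.pi * c k) := by
    intro k
    simp only [hcdef]
    split_ifs with hk
    · rw [mul_one, hp]
    · simp
  have hmem : ∀ k : Fin n, a (k + j) - a k + 2 * Real.pi * c k ∈ Set.Ioo 0 (2 * Real.pi) := by
    intro k
    simp only [hcdef]
    split_ifs with hk
    · have := ha hk
      have := hlt k (k + j)
      constructor <;> linarith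
    · have hne : k ≠ k + j := by simpa using hj0
      have := ha (lt_of_le_of_ne (not_lt.1 hk) hne)
      have := hlt (k + j) k
      constructor <;> linarith
  have hJ := hc.map_sum_le (t := Finset.univ) (w := fun _ : Fin n => (1 : ℝ) / n)
    (p := fun k => a (k + j) - a k + 2 * Real.pi * c k)
    (fun _ _ => by positivity) (by simp [hn.ne']) (fun k _ => hmem k)
  have hsum : ∑ k, (a (k + j) - a k + 2 * Real.pi * c k) = 2 * Real.pi * (j : ℕ) := by
    rw [Finset.sum_add_distrib, Finset.sum_sub_distrib, ← Finset.mul_sum, dub_count j,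
      Equiv.sum_comp (Equiv.addRight j) a |> (fun h => (h : ∑ k, a (k + j) = _))]
    ring
  rw [← Finset.smul_sum, ← Finset.smul_sum, hsum] at hJ
  simp only [hstar, hper]
  simp only [smul_eq_mul] at hJ
  have e : 1 / (n : ℝ) * (2 * Real.pi * (j : ℕ)) = 2 * Real.pi * (j : ℕ) / n := by ring
  rw [e] at hJ
  simp only [Finset.sum_const, Finset.card_univ, Fintype.card_fin, nsmul_eq_mul]
  calc (n : ℝ) * f (2 * Real.pi * (j : ℕ) / n) ≤ n * (1 / n * _) :=
        mul_le_mul_of_nonneg_left hJ hn.le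
    _ = _ := by field_simp

lemma dub_jensen {n : ℕ} [NeZero n] {f : ℝ → ℝ} (hc : ConvexOn ℝ (Set.Ioo 0 (2 * Real.pi)) f)
    (hp : Function.Periodic f (2 * Real.pi)) (a : Fin n → ℝ) (ha : Function.Injective a)
    (hlt : ∀ k l, a k - a l < 2 * Real.pi) :
    ∑ p ∈ (Finset.univ : Finset (Fin n)).offDiag,
      f (2 * Real.pi * ((p.1 : ℕ) + 1) / n - 2 * Real.pi * ((p.2 : ℕ) + 1) / n)
      ≤ ∑ p ∈ (Finset.univ : Finset (Fin n)).offDiag, f (a p.1 - a p.2) := by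
  have hm : StrictMono (a ∘ Tuple.sort a) :=
    (Tuple.monotone_sort a).strictMono_of_injective (ha.comp (Tuple.sort a).injective)
  refine (dub_jensen_mono hc hp _ hm (fun k l => hlt _ _)).trans (le_of_eq ?_)
  refine Finset.sum_equiv ((Tuple.sort a).prodCongr (Tuple.sort a)) ?_ ?_
  · rintro ⟨k, l⟩; simp
  · rintro ⟨k, l⟩ _; simp

lemma dub_norm_sub (s t x y : ℝ) :
    ‖(s : ℂ) * Complex.exp (x * Complex.I) - (t : ℂ) * Complex.exp (y * Complex.I)‖
      = Real.sqrt (s ^ 2 + t ^ 2 - 2 * s * t * Real.cos (x - y)) := by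
  rw [Complex.norm_def]
  congr 1
  rw [Complex.normSq_apply]
  simp only [Complex.sub_re, Complex.sub_im, Complex.re_ofReal_mul, Complex.im_ofReal_mul,
    Complex.exp_ofReal_mul_I_re, Complex.exp_ofReal_mul_I_im, Real.cos_sub]
  linear_combination s ^ 2 * Real.sin_sq_add_cos_sq x + t ^ 2 * Real.sin_sq_add_cos_sq y

lemma dub_prod_diag {n : ℕ} (P : Fin n → Fin n → ℝ) :
    ∏ k, ∏ l, P k l = (∏ k, P k k) * ∏ p ∈ (Finset.univ : Finset (Fin n)).offDiag, P p.1 p.2 := by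
  rw [← Finset.prod_product', ← Finset.diag_union_offDiag,
    Finset.prod_union (Finset.disjoint_diag_offDiag _), Finset.prod_diag]

lemma dub_eval {n : ℕ} {r R : ℝ} (hr : 0 < r) (hrR : r < R) (α β : ℝ) (a : Fin n → ℝ)
    (z ζ : Fin n → ℂ) (hz : ∀ k, z k = (r : ℂ) * Complex.exp (a k * Complex.I))
    (hζ : ∀ k, ζ k = (R : ℂ) * Complex.exp (a k * Complex.I)) (hinj : Function.Injective z) :
    (∏ k : Fin n, ∏ l : Fin n, ‖z k - ζ l‖ ^ (2 * α * β)) /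
        (∏ p ∈ (Finset.univ : Finset (Fin n)).offDiag,
          ‖z p.1 - z p.2‖ ^ (α ^ 2) *
            ‖ζ p.1 - ζ p.2‖ ^ (β ^ 2))
    = ((R - r) ^ (2 * α * β)) ^ n *
      Real.exp (∑ p ∈ (Finset.univ : Finset (Fin n)).offDiag, dubF r R α β (a p.1 - a p.2)) := by
  rw [dub_prod_diag, mul_div_assoc, ← Finset.prod_div_distrib, Real.exp_sum]
  congr 1
  · have : ∀ k, ‖z k - ζ k‖ = R - r := by
      intro k
      rw [hz, hζ, dub_norm_sub, sub_self, Real.cos_zero,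
        show r ^ 2 + R ^ 2 - 2 * r * R * 1 = (R - r) ^ 2 by ring, Real.sqrt_sq (by linarith)]
    simp [this]
  · refine Finset.prod_congr rfl ?_
    rintro ⟨k, l⟩ hkl
    have hne : z k ≠ z l := fun h => (by simpa using hkl : k ≠ l) (hinj h)
    have hR := hr.trans hrR
    have hD := dub_D_pos hr hrR (a k - a l)
    have hu : 0 < 1 - Real.cos (a k - a l) := by
      have h1 := norm_pos_iff.2 (sub_ne_zero.2 hne)
      rw [hz, hz, dub_norm_sub, Real.sqrt_pos] at h1
      have : 0 < 2 * r ^ 2 * (1 - Real.cos (a k - a l)) := by linarith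
      exact (mul_pos_iff_of_pos_left (by positivity)).1 this
    simp only
    have q : ∀ s : ℝ, 0 < s → ∀ c : ℝ, ‖(s : ℂ) * Complex.exp (a k * Complex.I)
        - (s : ℂ) * Complex.exp (a l * Complex.I)‖ ^ c = Real.exp ((Real.log (2 * s ^ 2) +
          Real.log (1 - Real.cos (a k - a l))) / 2 * c) := by
      intro s hs c
      rw [dub_norm_sub, show s ^ 2 + s ^ 2 - 2 * s * s * Real.cos (a k - a l)
        = (2 * s ^ 2) * (1 - Real.cos (a k - a l)) by ring,
        Real.rpow_def_of_pos (by positivity), Real.log_sqrt (by positivity),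
        Real.log_mul (by positivity) hu.ne']
    rw [hz k, hz l, hζ k, hζ l, q r hr, q R hR, dub_norm_sub,
      Real.rpow_def_of_pos (Real.sqrt_pos.2 hD), Real.log_sqrt hD.le, ← Real.exp_add,
      ← Real.exp_sub]
    congr 1
    unfold dubF
    ring

lemma dub_star_inj {n : ℕ} [NeZero n] {r : ℝ} (hr : 0 < r) {zs : Fin n → ℂ}
    (hzs : ∀ k, zs k = (r : ℂ) * Complex.exp (2 * Real.pi * Complex.I * ((k : ℕ) + 1) / n)) :
    Function.Injective zs := by
  intro k l h
  have hrc : (r : ℂ) ≠ 0 := by exact_mod_cast hr.ne'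
  rw [hzs, hzs] at h
  have h := mul_left_cancel₀ hrc h
  obtain ⟨m, hm⟩ := Complex.exp_eq_exp_iff_exists_int.1 h
  have hnc : (n : ℂ) ≠ 0 := Nat.cast_ne_zero.2 (NeZero.ne n)
  have hpi := Complex.two_pi_I_ne_zero
  have h3 : ((k : ℕ) : ℂ) = (l : ℕ) + m * n := by
    apply mul_left_cancel₀ hpi
    field_simp at hm
    linear_combination (2 * Real.pi * Complex.I) * hm
  have h4 : ((k : ℕ) : ℤ) = (l : ℕ) + m * n := by exact_mod_cast h3
  have hk := k.2
  have hl := l.2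
  have hm0 : m = 0 := by
    have h5 : m < 1 := by
      by_contra hh
      nlinarith
    have h6 : -1 < m := by
      by_contra hh
      nlinarith
    omega
  rw [hm0] at h4
  ext
  simpa using h4


/-- The dissymmetrization inequality of the paper for points on two concentric
circles lying on common radial rays: if `|z k| = r`, `ζ k = (R/r) * z k`
(`0 < r < R`, the `z k` pairwise distinct), and `z* k = r * exp(2πik/n)`,
`ζ* k = R * exp(2πik/n)` are the `Φₙ`-symmetric configurations, then for all
real `α, β`:
`(∏_{k,l} |z* k - ζ* l|^(2αβ)) / (∏_{k≠l} |z* k - z* l|^(α²) * |ζ* k - ζ* l|^(β²))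
  ≤ (∏_{k,l} |z k - ζ l|^(2αβ)) / (∏_{k≠l} |z k - z l|^(α²) * |ζ k - ζ l|^(β²))`,
all powers being real powers of strictly positive real bases. -/
theorem dubinin_concentric_circles (n : ℕ) (hn : 2 ≤ n) (r R : ℝ)
    (hr : 0 < r) (hrR : r < R)
    (z : Fin n → ℂ) (hz : ∀ k, ‖z k‖ = r) (hzinj : Function.Injective z)
    (ζ : Fin n → ℂ) (hζ : ∀ k, ζ k = ((R / r : ℝ) : ℂ) * z k)
    (zs ζs : Fin n → ℂ)
    (hzs : ∀ k, zs k = (r : ℂ) * Complex.exp (2 * Real.pi * Complex.I * ((k : ℕ) + 1) / n))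
    (hζs : ∀ k, ζs k = (R : ℂ) * Complex.exp (2 * Real.pi * Complex.I * ((k : ℕ) + 1) / n))
    (α β : ℝ) :
    (∏ k : Fin n, ∏ l : Fin n, ‖zs k - ζs l‖ ^ (2 * α * β)) /
        (∏ p ∈ (Finset.univ : Finset (Fin n)).offDiag,
          ‖zs p.1 - zs p.2‖ ^ (α ^ 2) *
            ‖ζs p.1 - ζs p.2‖ ^ (β ^ 2)) ≤
      (∏ k : Fin n, ∏ l : Fin n, ‖z k - ζ l‖ ^ (2 * α * β)) /
        (∏ p ∈ (Finset.univ : Finset (Fin n)).offDiag,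
          ‖z p.1 - z p.2‖ ^ (α ^ 2) *
            ‖ζ p.1 - ζ p.2‖ ^ (β ^ 2)) := by
  have : NeZero n := ⟨by omega⟩
  have hn0 : (n : ℝ) ≠ 0 := Nat.cast_ne_zero.2 (NeZero.ne n)
  have hz' : ∀ k, z k = (r : ℂ) * Complex.exp ((z k).arg * Complex.I) := by
    intro k
    conv_lhs => rw [← Complex.norm_mul_exp_arg_mul_I (z k), hz k]
  have hζ' : ∀ k, ζ k = (R : ℂ) * Complex.exp ((z k).arg * Complex.I) := by
    intro k
    have hrc : (r : ℂ) ≠ 0 := by exact_mod_cast hr.ne'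
    rw [hζ k]
    conv_lhs => rw [hz' k]
    push_cast
    rw [← mul_assoc, div_mul_cancel₀ _ hrc]
  have harg : Function.Injective (fun k => (z k).arg) := by
    intro k l h
    apply hzinj
    rw [hz' k, hz' l]
    simp only at h
    rw [h]
  have hlt : ∀ k l, (z k).arg - (z l).arg < 2 * Real.pi := by
    intro k l
    have := Complex.arg_le_pi (z k)
    have := Complex.neg_pi_lt_arg (z l)
    linarith
  have hexp : ∀ k : Fin n, Complex.exp (2 * Real.pi * Complex.I * ((k : ℕ) + 1) / n)
      = Complex.exp (((2 * Real.pi * ((k : ℕ) + 1) / n : ℝ) : ℂ) * Complex.I) := by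
    intro k
    congr 1
    push_cast
    ring
  have hsinj : Function.Injective zs := dub_star_inj hr hzs
  have e1 := dub_eval hr hrR α β (fun k => (z k).arg) z ζ hz' hζ' hzinj
  have e2 := dub_eval hr hrR α β (fun k : Fin n => 2 * Real.pi * ((k : ℕ) + 1) / n) zs ζs
      (fun k => (hzs k).trans (congrArg _ (hexp k)))
      (fun k => (hζs k).trans (congrArg _ (hexp k))) hsinj
  have e3 := dub_jensen (dubF_convex hr hrR α β) (dubF_periodic r R α β) _ harg hlt
  have h0 : 0 ≤ ((R - r) ^ (2 * α * β)) ^ n :=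
    pow_nonneg (Real.rpow_nonneg (by linarith) _) _
  exact e2.trans_le ((mul_le_mul_of_nonneg_left (Real.exp_le_exp.2 e3) h0).trans e1.symm.le)
end

section
/- Let n ≥ 2 and r > 0, and let z_1, …, z_n be complex numbers with |z_k| = r for all k. Then ∏_{k≠l} |z_k − z_l| ≤ n^n · r^{n(n−1)}, where the product ranges over all ordered pairs (k,l) with k ≠ l. Equality holds when the z_k are the n-th roots of unity scaled by r, i.e., z_k = r·exp(2πik/n). -/
theorem schur_aux_prod (n : ℕ) (w : Fin n → ℂ) :
    (∏ p ∈ (Finset.univ : Finset (Fin n)).offDiag, ‖w p.1 - w p.2‖) =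
      ‖(Matrix.vandermonde w).det‖ ^ 2 := by
  have h1 : (∏ p ∈ (Finset.univ : Finset (Fin n)).offDiag, ‖w p.1 - w p.2‖) =
      ∏ i : Fin n, ∏ j ∈ ({i}ᶜ : Finset (Fin n)), ‖w j - w i‖ := by
    rw [Finset.prod_sigma']
    refine Finset.prod_bij' (fun p _ => ⟨p.2, p.1⟩) (fun s _ => (s.2, s.1)) ?_ ?_ ?_ ?_ ?_ <;>
      simp
  rw [h1, ← Finset.prod_prod_Ioi_mul_eq_prod_prod_off_diag, Matrix.det_vandermonde, norm_prod,
    ← Finset.prod_pow]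
  refine Finset.prod_congr rfl fun i _ => ?_
  rw [norm_prod, ← Finset.prod_pow]
  refine Finset.prod_congr rfl fun j _ => ?_
  rw [norm_sub_rev (w i) (w j), sq]

theorem schur_aux_amgm (n : ℕ) (hn : 2 ≤ n) (x : Fin n → ℝ) (hx : ∀ i, 0 ≤ x i)
    (hs : ∑ i, x i = (n : ℝ) * n) : ∏ i, x i ≤ (n : ℝ) ^ n := by
  have hn0 : (n : ℝ) ≠ 0 := by positivity
  have h := Real.geom_mean_le_arith_mean_weighted Finset.univ (fun _ : Fin n => (n : ℝ)⁻¹) x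
    (fun _ _ => by positivity) (by simp [hn0]) (fun i _ => hx i)
  rw [← Finset.mul_sum, hs, inv_mul_cancel_left₀ hn0] at h
  have h2 := pow_le_pow_left₀ (Finset.prod_nonneg fun i _ => Real.rpow_nonneg (hx i) _) h n
  rw [← Finset.prod_pow] at h2
  refine le_trans (le_of_eq ?_) h2
  refine Finset.prod_congr rfl fun i _ => ?_
  rw [Real.rpow_inv_natCast_pow (hx i) (by omega)]

theorem schur_aux_det (n : ℕ) (V : Matrix (Fin n) (Fin n) ℂ) :
    (V * V.conjTranspose).det = ((‖V.det‖ ^ 2 : ℝ) : ℂ) := by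
  rw [Matrix.det_mul, Matrix.det_conjTranspose]
  simpa using Complex.mul_conj' V.det

open scoped ComplexOrder in
theorem schur_aux_le (n : ℕ) (hn : 2 ≤ n) (w : Fin n → ℂ) (hw : ∀ k, ‖w k‖ = 1) :
    ‖(Matrix.vandermonde w).det‖ ^ 2 ≤ (n : ℝ) ^ n := by
  set V := Matrix.vandermonde w with hV
  have hP : (V * V.conjTranspose).PosSemidef := Matrix.posSemidef_self_mul_conjTranspose V
  have hd := schur_aux_det n V
  have ht : (V * V.conjTranspose).trace = ((n * n : ℝ) : ℂ) := by
    simp only [Matrix.trace, Matrix.diag, Matrix.mul_apply, Matrix.conjTranspose_apply, hV,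
      Matrix.vandermonde_apply]
    have : ∀ i j : Fin n, w i ^ (j : ℕ) * star (w i ^ (j : ℕ)) = 1 := by
      intro i j
      have := Complex.mul_conj' (w i ^ (j : ℕ))
      simpa [hw] using this
    simp only [this]
    simp
  rw [hP.isHermitian.det_eq_prod_eigenvalues] at hd
  rw [hP.isHermitian.trace_eq_sum_eigenvalues] at ht
  have hd' : ∏ i, hP.isHermitian.eigenvalues i = ‖V.det‖ ^ 2 := by
    apply Complex.ofReal_injective
    rw [Complex.ofReal_prod]
    exact hd
  have ht' : ∑ i, hP.isHermitian.eigenvalues i = (n : ℝ) * n := by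
    apply Complex.ofReal_injective
    rw [Complex.ofReal_sum]
    exact ht
  rw [← hd']
  exact schur_aux_amgm n hn _ hP.eigenvalues_nonneg ht'

theorem schur_aux_eq (n : ℕ) (hn : 2 ≤ n) (w : Fin n → ℂ) (hw : ∀ k, ‖w k‖ = 1)
    (hp : ∀ k, w k ^ n = 1) (hi : Function.Injective w) :
    ‖(Matrix.vandermonde w).det‖ ^ 2 = (n : ℝ) ^ n := by
  have hd := schur_aux_det n (Matrix.vandermonde w)
  have hG : Matrix.vandermonde w * (Matrix.vandermonde w).conjTranspose =
      Matrix.diagonal (fun _ => (n : ℂ)) := by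
    ext k l
    have hl : w l ≠ 0 := by
      intro h
      have := hw l
      simp [h] at this
    have hs : ∀ j : Fin n, w k ^ (j : ℕ) * star (w l ^ (j : ℕ)) = (w k / w l) ^ (j : ℕ) := by
      intro j
      have h1 : star (w l) = (w l)⁻¹ := by
        rw [Complex.inv_eq_conj (hw l)]; rfl
      rw [star_pow, h1, ← mul_pow, div_eq_mul_inv]
    simp only [Matrix.mul_apply, Matrix.conjTranspose_apply, Matrix.vandermonde_apply, hs,
      Matrix.diagonal_apply]
    split_ifs with h
    · subst h
      simp [div_self hl]
    · rw [Fin.sum_univ_eq_sum_range (fun j => (w k / w l) ^ j) n]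
      have hne : 1 - w k / w l ≠ 0 := by
        rw [sub_ne_zero]
        intro h'
        exact h (hi ((div_eq_one_iff_eq hl).1 h'.symm))
      refine (mul_eq_zero.1 ?_).resolve_left hne
      rw [mul_neg_geom_sum, div_pow, hp, hp, div_one, sub_self]
  rw [hG, Matrix.det_diagonal] at hd
  simp only [Finset.prod_const, Finset.card_univ, Fintype.card_fin] at hd
  exact_mod_cast hd.symm


/-- Schur's classical inequality: for points `z 1, …, z n` on the circle `|z| = r`,
the product of mutual distances over all ordered pairs of distinct indices satisfies
`∏_{k ≠ l} |z k - z l| ≤ n^n * r^(n(n-1))`, with equality when the `z k` are the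
`n`-th roots of unity scaled by `r`, i.e. `z k = r * exp(2πik/n)`. -/
theorem schur_circle_inequality (n : ℕ) (hn : 2 ≤ n) (r : ℝ) (hr : 0 < r)
    (z : Fin n → ℂ) (hz : ∀ k, ‖z k‖ = r) :
    (∏ p ∈ (Finset.univ : Finset (Fin n)).offDiag, ‖z p.1 - z p.2‖) ≤
      (n : ℝ) ^ n * r ^ (n * (n - 1)) ∧
    ((∀ k : Fin n,
        z k = (r : ℂ) * Complex.exp (2 * Real.pi * Complex.I * ((k : ℕ) + 1) / n)) →
      (∏ p ∈ (Finset.univ : Finset (Fin n)).offDiag, ‖z p.1 - z p.2‖) =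
        (n : ℝ) ^ n * r ^ (n * (n - 1))) := by
  have hr0 : (r : ℂ) ≠ 0 := by exact_mod_cast hr.ne'
  have hw : ∀ k, ‖z k / r‖ = 1 := by
    intro k
    rw [norm_div, hz, Complex.norm_real, Real.norm_of_nonneg hr.le, div_self hr.ne']
  have key : (∏ p ∈ (Finset.univ : Finset (Fin n)).offDiag, ‖z p.1 - z p.2‖) =
      ‖(Matrix.vandermonde (fun k => z k / r)).det‖ ^ 2 * r ^ (n * (n - 1)) := by
    rw [← schur_aux_prod]
    have hc : (Finset.univ : Finset (Fin n)).offDiag.card = n * (n - 1) := by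
      rw [Finset.offDiag_card]
      simp [Nat.mul_sub]
    rw [← hc, ← Finset.prod_const, ← Finset.prod_mul_distrib]
    refine Finset.prod_congr rfl fun p _ => ?_
    rw [← sub_div, norm_div, Complex.norm_real, Real.norm_of_nonneg hr.le,
      div_mul_cancel₀ _ hr.ne']
  rw [key]
  refine ⟨mul_le_mul_of_nonneg_right (schur_aux_le n hn _ hw) (by positivity), fun h => ?_⟩
  have hζ := Complex.isPrimitiveRoot_exp n (by omega)
  have hk : ∀ k : Fin n, z k / r =
      Complex.exp (2 * Real.pi * Complex.I / n) ^ ((k : ℕ) + 1) := by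
    intro k
    rw [h k, mul_div_cancel_left₀ _ hr0, ← Complex.exp_nat_mul]
    congr 1
    push_cast
    ring
  rw [schur_aux_eq n hn _ hw]
  · intro k
    rw [hk, pow_right_comm, hζ.pow_eq_one, one_pow]
  · intro k l hkl
    simp only [hk, pow_succ] at hkl
    have := mul_right_cancel₀ (Complex.exp_ne_zero _) hkl
    exact Fin.ext (hζ.pow_inj k.2 l.2 this)
end
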